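/- For all real numbers x, y, t with 4|y||t| < 1, the series Σ_{r=0}^∞ (t^r / r!) · H_{2r}(x,y) converges absolutely and equals (1 - 4yt)^{-1/2} · e^{x² t / (1 - 4yt)}. -/

import Mathlib

open Real

/-- Two-variable Hermite (Kampé de Fériet) polynomials
`H_n(x,y) = n! ∑_{s=0}^{⌊n/2⌋} x^(n-2s) y^s / ((n-2s)! s!)`. -/
noncomputable def hermite2 (n : ℕ) (x y : ℝ) : ℝ :=
  (n.factorial : ℝ) * ∑ s ∈ Finset.range (n / 2 + 1),
    x ^ (n - 2 * s) * y ^ s / ((Nat.factorial (n - 2 * s) : ℝ) * (Nat.factorial s : ℝ))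

/-- Coefficient of the double series. -/
noncomputable def hcoef (k s : ℕ) : ℝ :=
  ((2 * (k + s)).factorial : ℝ) / (((k + s).factorial : ℝ) * ((2 * k).factorial : ℝ) * (s.factorial : ℝ))

theorem hcoef_nonneg (k s : ℕ) : 0 ≤ hcoef k s := by
  unfold hcoef; positivity

theorem fact_aux (k s : ℕ) :
    ((2 * (k + s)).factorial : ℝ) * (k.factorial : ℝ) =
      4 ^ s * (ascPochhammer ℝ s).eval ((k : ℝ) + 1 / 2) * ((k + s).factorial : ℝ) *
        ((2 * k).factorial : ℝ) := by
  induction s with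
  | zero => simp; ring
  | succ s ih =>
    have e : 2 * (k + (s + 1)) = (2 * (k + s) + 1) + 1 := by ring
    have e' : k + (s + 1) = (k + s) + 1 := by ring
    rw [e, e', Nat.factorial_succ, Nat.factorial_succ, Nat.factorial_succ, ascPochhammer_succ_eval,
      pow_succ]
    push_cast
    linear_combination (2 * ((k : ℝ) + s) + 1 + 1) * (2 * ((k : ℝ) + s) + 1) * ih

theorem choose_aux (k s : ℕ) :
    Ring.choose ((k : ℝ) + 1 / 2 + s - 1) s * 4 ^ s = hcoef k s * (k.factorial : ℝ) := by
  have h1 := Ring.factorial_nsmul_multichoose_eq_ascPochhammer ((k : ℝ) + 1 / 2) s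
  rw [Ring.multichoose_eq, Polynomial.ascPochhammer_smeval_eq_eval, nsmul_eq_mul] at h1
  have h2 := fact_aux k s
  rw [← h1] at h2
  unfold hcoef
  have := Nat.factorial_ne_zero
  have a1 : ((k + s).factorial : ℝ) ≠ 0 := by exact_mod_cast this _
  have a2 : ((2 * k).factorial : ℝ) ≠ 0 := by exact_mod_cast this _
  have a3 : (s.factorial : ℝ) ≠ 0 := by exact_mod_cast this _
  field_simp
  field_simp at h2
  linear_combination -h2

theorem inner_hasSum (k : ℕ) (z w : ℝ) (hz : |4 * z| < 1) :
    HasSum (fun s : ℕ => hcoef k s * w ^ k * z ^ s)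
      ((1 - 4 * z) ^ (-(1 : ℝ) / 2) * ((w / (1 - 4 * z)) ^ k / (k.factorial : ℝ))) := by
  have h := (Real.one_div_one_sub_rpow_hasFPowerSeriesOnBall_zero ((k : ℝ) + 1 / 2)).hasSum
    (y := 4 * z) (by
      rw [← ENNReal.ofReal_one, Metric.eball_ofReal]
      simpa [Real.norm_eq_abs] using hz)
  have h' := h.mul_right (w ^ k / (k.factorial : ℝ))
  have a3 : (k.factorial : ℝ) ≠ 0 := by exact_mod_cast Nat.factorial_ne_zero _
  have hp : 0 < 1 - 4 * z := by linarith [(abs_lt.1 hz).2]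
  convert! h' using 1
  · funext s
    have := choose_aux k s
    simp only [FormalMultilinearSeries.ofScalars_apply_eq, smul_eq_mul, mul_pow]
    generalize Ring.choose ((k : ℝ) + 1 / 2 + s - 1) s = c at this ⊢
    field_simp
    linear_combination -(z ^ s * w ^ k) * this
  · rw [zero_add, Real.rpow_add hp, Real.rpow_natCast, neg_div, Real.rpow_neg hp.le, div_pow]
    have := (Real.rpow_pos_of_pos hp (1 / 2)).ne'
    field_simp

theorem outer_hasSum (z w : ℝ) :
    HasSum (fun k : ℕ => (1 - 4 * z) ^ (-(1 : ℝ) / 2) * ((w / (1 - 4 * z)) ^ k / (k.factorial : ℝ)))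
      ((1 - 4 * z) ^ (-(1 : ℝ) / 2) * Real.exp (w / (1 - 4 * z))) := by
  rw [Real.exp_eq_exp_ℝ]
  exact (NormedSpace.expSeries_div_hasSum_exp (w / (1 - 4 * z))).mul_left _

theorem double_summable (z w : ℝ) (hz : |4 * z| < 1) :
    Summable (fun p : ℕ × ℕ => |hcoef p.1 p.2 * w ^ p.1 * z ^ p.2|) := by
  have e : (fun p : ℕ × ℕ => |hcoef p.1 p.2 * w ^ p.1 * z ^ p.2|) =
      fun p : ℕ × ℕ => hcoef p.1 p.2 * |w| ^ p.1 * |z| ^ p.2 := by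
    funext p
    rw [abs_mul, abs_mul, abs_pow, abs_pow, abs_of_nonneg (hcoef_nonneg _ _)]
  have hz' : |4 * abs z| < 1 := by
    rw [abs_mul] at hz ⊢
    simpa using hz
  rw [e, summable_prod_of_nonneg]
  · refine ⟨fun k => (inner_hasSum k |z| |w| hz').summable, ?_⟩
    convert (outer_hasSum |z| |w|).summable using 2 with k
    exact (inner_hasSum k |z| |w| hz').tsum_eq
  · intro p
    have := hcoef_nonneg p.1 p.2
    simp only [Pi.zero_apply]
    positivity

theorem double_hasSum (z w : ℝ) (hz : |4 * z| < 1) :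
    HasSum (fun p : ℕ × ℕ => hcoef p.1 p.2 * w ^ p.1 * z ^ p.2)
      ((1 - 4 * z) ^ (-(1 : ℝ) / 2) * Real.exp (w / (1 - 4 * z))) := by
  have hs : Summable (fun p : ℕ × ℕ => hcoef p.1 p.2 * w ^ p.1 * z ^ p.2) :=
    (double_summable z w hz).of_abs
  have h1 := hs.hasSum.prod_fiberwise (fun k => inner_hasSum k z w hz)
  rw [← h1.unique (outer_hasSum z w)]
  exact hs.hasSum

theorem antidiag_hasSum {f : ℕ × ℕ → ℝ} {a : ℝ} (h : HasSum f a) :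
    HasSum (fun n => ∑ p ∈ Finset.HasAntidiagonal.antidiagonal n, f p) a := by
  have h1 := (Finset.HasAntidiagonal.sigmaAntidiagonalEquivProd (A := ℕ)).hasSum_iff.2 h
  refine h1.sigma fun n => ?_
  have := hasSum_fintype (fun c : Finset.HasAntidiagonal.antidiagonal n => f c)
  rw [Finset.sum_coe_sort (Finset.HasAntidiagonal.antidiagonal n) f] at this
  exact this

theorem term_eq (x y t : ℝ) (r : ℕ) :
    t ^ r / (Nat.factorial r : ℝ) * hermite2 (2 * r) x y =
      ∑ p ∈ Finset.HasAntidiagonal.antidiagonal r, hcoef p.1 p.2 * (x ^ 2 * t) ^ p.1 * (y * t) ^ p.2 := by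
  rw [← Finset.Nat.sum_antidiagonal_swap, Finset.Nat.sum_antidiagonal_eq_sum_range_succ_mk]
  unfold hermite2
  rw [Nat.mul_div_cancel_left r (by norm_num : 0 < 2), Finset.mul_sum, Finset.mul_sum]
  refine Finset.sum_congr rfl fun s hs => ?_
  obtain ⟨k, rfl⟩ := Nat.exists_eq_add_of_le' (Nat.lt_succ_iff.1 (Finset.mem_range.1 hs))
  have e : 2 * (k + s) - 2 * s = 2 * k := by omega
  simp only [Prod.swap, e, Nat.add_sub_cancel, hcoef]
  field_simp
  ring

theorem generating_function_even_hermite2 (x y t : ℝ) (h : 4 * |y| * |t| < 1) :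
    Summable (fun r : ℕ => |t ^ r / (Nat.factorial r : ℝ) * hermite2 (2 * r) x y|) ∧
    ∑' r : ℕ, t ^ r / (Nat.factorial r : ℝ) * hermite2 (2 * r) x y
      = (1 - 4 * y * t) ^ (-(1 : ℝ) / 2) * Real.exp (x ^ 2 * t / (1 - 4 * y * t)) := by
  have hz : |4 * (y * t)| < 1 := by
    rw [abs_mul, abs_mul, ← mul_assoc]
    simpa using h
  simp only [term_eq]
  constructor
  · refine Summable.of_nonneg_of_le (fun _ => abs_nonneg _)
      (fun r => Finset.abs_sum_le_sum_abs _ _)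
      (antidiag_hasSum (double_summable (y * t) (x ^ 2 * t) hz).hasSum).summable
  · rw [mul_assoc 4 y t]
    exact (antidiag_hasSum (double_hasSum (y * t) (x ^ 2 * t) hz)).tsum_eq
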